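/- arXiv:1911.03017 — 3 statements merged into one kernel-verified Lean document; each statement's English description precedes it below -/
import Mathlib

section
/- Let d ≥ 1, α > 0, Σ ∈ ℝ^{d×d} positive definite, and x, μ ∈ ℝ^d with x ≠ μ, and write D² = D²(x; μ, Σ) > 0. Then ∫₁^∞ (2πw)^(−d/2) (det Σ)^(−1/2) exp(−D²/(2w)) · α w^(−α−1) dw = α / √((2π)^d det Σ) · (D²/2)^(−d/2−α) · γ(α + d/2, D²/2). That is, mixing the N_d(μ, wΣ) density against the Pareto density w ↦ α w^(−α−1) on (1, ∞) gives the Pareto normal variance mixture density in terms of the lower incomplete gamma function. -/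
open Real Set Matrix MeasureTheory

/-- The lower incomplete gamma function `γ(s, x) = ∫₀ˣ t^(s-1) e^(-t) dt`. -/
noncomputable def lowerGamma (s x : ℝ) : ℝ :=
  ∫ t in (0 : ℝ)..x, t ^ (s - 1) * Real.exp (-t)

/-- Mixing the `N_d(μ, wΣ)` density against the Pareto density
`w ↦ α w^(-α-1)` on `(1, ∞)` gives the Pareto normal variance mixture density
in terms of the lower incomplete gamma function. -/
theorem stmt_6 (d : ℕ) (hd : 1 ≤ d) (α : ℝ) (hα : 0 < α)
    (S : Matrix (Fin d) (Fin d) ℝ) (hS : S.PosDef)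
    (x μ : Fin d → ℝ) (hxμ : x ≠ μ)
    (D2 : ℝ) (hD2 : D2 = (x - μ) ⬝ᵥ (S⁻¹ *ᵥ (x - μ))) :
    (∫ w in Set.Ioi (1 : ℝ),
        (2 * π * w) ^ (-(d : ℝ) / 2) * S.det ^ (-(1 : ℝ) / 2) *
          Real.exp (-D2 / (2 * w)) * (α * w ^ (-α - 1))) =
      α / Real.sqrt ((2 * π) ^ (d : ℝ) * S.det) * (D2 / 2) ^ (-(d : ℝ) / 2 - α) *
        lowerGamma (α + d / 2) (D2 / 2) := by
  have hdet : 0 < S.det := hS.det_pos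
  have hD : 0 < D2 := by
    have h := hS.inv.dotProduct_mulVec_pos (sub_ne_zero.mpr hxμ)
    rw [hD2]
    simpa using h
  obtain ⟨c, hc⟩ : ∃ c, c = D2 / 2 := ⟨_, rfl⟩
  have hc0 : 0 < c := by rw [hc]; positivity
  have himg : (fun w : ℝ => c / w) '' Set.Ioi 1 = Set.Ioo 0 c := by
    ext t
    simp only [Set.mem_image, Set.mem_Ioi, Set.mem_Ioo]
    constructor
    · rintro ⟨w, hw, rfl⟩
      have hw0 : 0 < w := by linarith
      exact ⟨by positivity, div_lt_self hc0 hw⟩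
    · rintro ⟨h0, h1⟩
      exact ⟨c / t, (one_lt_div h0).mpr h1, by field_simp⟩
  have hG : lowerGamma (α + d / 2) c = ∫ w in Set.Ioi (1 : ℝ),
      |(-c / w ^ 2)| • ((c / w) ^ (α + d / 2 - 1) * Real.exp (-(c / w))) := by
    unfold lowerGamma
    rw [intervalIntegral.integral_of_le hc0.le, integral_Ioc_eq_integral_Ioo, ← himg]
    refine integral_image_eq_integral_abs_deriv_smul (f := fun w : ℝ => c / w)
      (f' := fun w => -c / w ^ 2) measurableSet_Ioi ?_ ?_
      (fun t => t ^ (α + d / 2 - 1) * Real.exp (-t))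
    · intro w hw
      have hw0 : w ≠ 0 := by
        have : (1 : ℝ) < w := hw
        linarith
      have h := (hasDerivAt_inv hw0).const_mul c
      refine HasDerivAt.hasDerivWithinAt ?_
      have h2 : c * -(w ^ 2)⁻¹ = -c / w ^ 2 := by ring
      rw [h2] at h
      exact h
    · intro a ha b hb hab
      have ha' : (1 : ℝ) < a := ha
      have hb' : (1 : ℝ) < b := hb
      have ha0 : a ≠ 0 := by linarith
      have hb0 : b ≠ 0 := by linarith
      simp only at hab
      field_simp at hab
      exact hab.symm
  rw [← hc, hG, ← integral_const_mul]
  refine setIntegral_congr_fun measurableSet_Ioi ?_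
  intro w hw
  have hw0 : 0 < w := lt_trans one_pos hw
  have hpi := Real.pi_pos
  have e1 : (2 * π * w) ^ (-(d : ℝ) / 2) = (2 * π) ^ (-(d : ℝ) / 2) * w ^ (-(d : ℝ) / 2) :=
    Real.mul_rpow (by positivity) hw0.le
  have e2 : α / Real.sqrt ((2 * π) ^ (d : ℝ) * S.det)
      = α * ((2 * π) ^ (-(d : ℝ) / 2) * S.det ^ (-(1 : ℝ) / 2)) := by
    rw [div_eq_mul_inv, Real.sqrt_eq_rpow, ← Real.rpow_neg (by positivity),
      Real.mul_rpow (by positivity) hdet.le, ← Real.rpow_mul (by positivity)]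
    congr 3 <;> ring_nf
  have e3 : -D2 / (2 * w) = -(c / w) := by rw [hc]; field_simp
  have e4 : |(-c / w ^ 2)| = c * w ^ (-2 : ℝ) := by
    rw [neg_div, abs_neg, abs_of_pos (by positivity), Real.rpow_neg hw0.le, div_eq_mul_inv]
    norm_num
  have e5 : (c / w) ^ (α + d / 2 - 1) = c ^ (α + d / 2 - 1 : ℝ) * w ^ (-(α + d / 2 - 1) : ℝ) := by
    rw [Real.div_rpow hc0.le hw0.le, Real.rpow_neg hw0.le, div_eq_mul_inv]
  have e6 : c ^ (-(d : ℝ) / 2 - α) * (c * c ^ (α + d / 2 - 1 : ℝ)) = 1 := by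
    nth_rewrite 2 [← Real.rpow_one c]
    rw [← Real.rpow_add hc0, ← Real.rpow_add hc0]
    ring_nf
    exact Real.rpow_zero c
  have e7 : w ^ (-2 : ℝ) * w ^ (-(α + d / 2 - 1) : ℝ) = w ^ (-(d : ℝ) / 2) * w ^ (-α - 1) := by
    rw [← Real.rpow_add hw0, ← Real.rpow_add hw0]
    ring_nf
  simp only [smul_eq_mul]
  rw [e1, e2, e3, e4, e5]
  generalize Real.exp (-(c / w)) = E
  generalize (2 * π) ^ (-(d : ℝ) / 2) = P
  generalize S.det ^ (-(1 : ℝ) / 2) = Q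
  linear_combination (-α * P * Q * E * (w ^ (-2 : ℝ) * w ^ (-(α + d / 2 - 1) : ℝ))) * e6
    - (α * P * Q * E) * e7
end

section
/- The supremum of f over ℝ^d equals f(μ) = (2π)^(−d/2) (det Σ)^(−1/2) · ∫ w^(−d/2) ρ(dw), where the integral is taken in [0, ∞]. Consequently, f is bounded on ℝ^d if and only if ∫ w^(−d/2) ρ(dw) < ∞, i.e., if and only if E(W^(−d/2)) < ∞ for the mixing variable W with law ρ. -/
open Real Set Matrix MeasureTheory
open scoped ENNReal

/-- The supremum over `ℝ^d` of the normal variance mixture density `f`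
equals `f(μ) = (2π)^(-d/2) (det Σ)^(-1/2) ∫ w^(-d/2) ρ(dw)` (taken in `[0,∞]`), and
`f` is bounded on `ℝ^d` if and only if `E(W^(-d/2)) < ∞` for the mixing law `ρ`. -/
theorem stmt_12 (d : ℕ) (hd : 1 ≤ d)
    (S : Matrix (Fin d) (Fin d) ℝ) (hS : S.PosDef) (μ : Fin d → ℝ)
    (ρ : Measure ℝ) [IsProbabilityMeasure ρ] (hρ : ρ (Set.Ioi 0) = 1)
    (D2 : (Fin d → ℝ) → ℝ) (hD2 : ∀ x, D2 x = (x - μ) ⬝ᵥ (S⁻¹ *ᵥ (x - μ)))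
    (f : (Fin d → ℝ) → ℝ≥0∞)
    (hf : ∀ x, f x = ∫⁻ w, ENNReal.ofReal ((2 * π * w) ^ (-(d : ℝ) / 2) *
        S.det ^ (-(1 : ℝ) / 2) * Real.exp (-(D2 x) / (2 * w))) ∂ρ) :
    (⨆ x, f x) = f μ ∧
    f μ = ENNReal.ofReal ((2 * π) ^ (-(d : ℝ) / 2) * S.det ^ (-(1 : ℝ) / 2)) *
        ∫⁻ w, ENNReal.ofReal (w ^ (-(d : ℝ) / 2)) ∂ρ ∧
    ((∃ C : ℝ≥0∞, C < ⊤ ∧ ∀ x, f x ≤ C) ↔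
      (∫⁻ w, ENNReal.ofReal (w ^ (-(d : ℝ) / 2)) ∂ρ) < ⊤) := by
  have hdet : 0 < S.det := hS.det_pos
  have hae : ∀ᵐ w ∂ρ, 0 < w := by
    have := (prob_compl_eq_zero_iff (μ := ρ) (measurableSet_Ioi (a := (0 : ℝ)))).2 hρ
    exact this
  have hD0 : D2 μ = 0 := by rw [hD2]; simp
  have hDn : ∀ x, 0 ≤ D2 x := by
    intro x
    rw [hD2]
    have h := hS.inv.posSemidef.dotProduct_mulVec_nonneg (x - μ)
    simpa using h
  have hle : ∀ x, f x ≤ f μ := by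
    intro x
    rw [hf, hf]
    apply lintegral_mono_ae
    filter_upwards [hae] with w hw
    apply ENNReal.ofReal_le_ofReal
    apply mul_le_mul_of_nonneg_left
    · apply Real.exp_le_exp.2
      rw [hD0]
      have := hDn x
      gcongr
    · positivity
  have hc : 0 < (2 * π) ^ (-(d : ℝ) / 2) * S.det ^ (-(1 : ℝ) / 2) := by positivity
  have hmu : f μ = ENNReal.ofReal ((2 * π) ^ (-(d : ℝ) / 2) * S.det ^ (-(1 : ℝ) / 2)) *
        ∫⁻ w, ENNReal.ofReal (w ^ (-(d : ℝ) / 2)) ∂ρ := by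
    rw [hf, ← lintegral_const_mul' _ _ ENNReal.ofReal_ne_top]
    apply lintegral_congr_ae
    filter_upwards [hae] with w hw
    rw [← ENNReal.ofReal_mul hc.le, hD0, Real.mul_rpow (by positivity) hw.le]
    congr 1
    simp only [neg_zero, zero_div, Real.exp_zero]
    ring
  refine ⟨le_antisymm (iSup_le hle) (le_iSup f μ), hmu, ?_, ?_⟩
  · rintro ⟨C, hC, h⟩
    have h1 := (h μ).trans_lt hC
    rw [hmu] at h1
    by_contra hn
    rw [not_lt, top_le_iff] at hn
    rw [hn, ENNReal.mul_top (ENNReal.ofReal_pos.2 hc).ne'] at h1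
    exact lt_irrefl _ h1
  · intro h
    refine ⟨f μ, ?_, hle⟩
    rw [hmu]
    exact ENNReal.mul_lt_top ENNReal.ofReal_lt_top h
end

section
/- Let d ≥ 1 and let Z = (Z₁, …, Z_d) have law equal to the d-fold product of standard normal distributions N(0,1). Then the law of ∑_{i=1}^d Zᵢ² is the gamma distribution with shape d/2 and rate 1/2 (i.e., the chi-squared distribution with d degrees of freedom): the pushforward of the product Gaussian measure under z ↦ ∑ᵢ zᵢ² equals the gamma measure with density x ↦ (1/2)^{d/2}/Γ(d/2) · x^{d/2−1} e^{−x/2} on (0, ∞). -/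
open Real Set MeasureTheory ProbabilityTheory

lemma aux_mgf_gauss (d : ℕ) (t : ℝ) :
    mgf id (Measure.map (fun z : Fin d → ℝ => ∑ i, (z i) ^ 2)
        (Measure.pi fun _ : Fin d => gaussianReal 0 1)) t
      = ((√(2 * π))⁻¹ * √(π / (1 / 2 - t))) ^ d := by
  have h1 : ∫ x, rexp (t * x ^ 2) ∂(gaussianReal 0 1) = (√(2 * π))⁻¹ * √(π / (1 / 2 - t)) := by
    rw [integral_gaussianReal_eq_integral_smul one_ne_zero, ← integral_gaussian,
      ← integral_const_mul]
    congr 1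
    ext x
    simp only [gaussianPDFReal, smul_eq_mul, NNReal.coe_one, mul_one, sub_zero, mul_assoc,
      ← Real.exp_add]
    congr 2
    ring
  rw [mgf, integral_map (Measurable.aemeasurable (by fun_prop)) (by fun_prop), ← h1]
  have h2 := integral_fintype_prod_eq_pow (ι := Fin d) (μ := gaussianReal 0 1) (fun x : ℝ => rexp (t * x ^ 2))
  rw [Fintype.card_fin] at h2
  rw [← h2]
  congr 1
  ext z
  simp only [id, Finset.mul_sum, Real.exp_sum]

lemma aux_mgf_gamma (a : ℝ) (ha : 0 < a) (t : ℝ) :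
    mgf id (gammaMeasure a (1 / 2)) t
      = (1 / 2) ^ a / Gamma a * ∫ x in Ioi (0 : ℝ), x ^ (a - 1) * rexp (-((1 / 2 - t) * x)) := by
  rw [mgf, gammaMeasure, integral_withDensity_eq_integral_toReal_smul
    (by unfold gammaPDF; fun_prop) (ae_of_all _ fun _ ↦ by simp [gammaPDF]),
    ← integral_const_mul, ← integral_Ici_eq_integral_Ioi, ← integral_indicator measurableSet_Ici]
  congr 1
  ext x
  rw [gammaPDF, ENNReal.toReal_ofReal (gammaPDFReal_nonneg ha (by norm_num) x)]
  by_cases hx : 0 ≤ x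
  · rw [indicator_of_mem (by exact hx), gammaPDFReal, if_pos hx]
    simp only [id, smul_eq_mul, mul_assoc, ← Real.exp_add]
    congr 4
    ring
  · rw [indicator_of_notMem (by exact hx), gammaPDFReal, if_neg hx]
    simp

lemma aux_mgf_eq (d : ℕ) (hd : 1 ≤ d) :
    mgf id (Measure.map (fun z : Fin d → ℝ => ∑ i, (z i) ^ 2)
        (Measure.pi fun _ : Fin d => gaussianReal 0 1)) =
      mgf id (gammaMeasure ((d : ℝ) / 2) (1 / 2)) := by
  have ha : 0 < (d : ℝ) / 2 := by
    have : 0 < d := hd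
    positivity
  ext t
  rw [aux_mgf_gauss, aux_mgf_gamma _ ha]
  by_cases ht : t < 1 / 2
  · have hb : 0 < 1 / 2 - t := by linarith
    have hG := (Gamma_pos_of_pos ha).ne'
    rw [integral_rpow_mul_exp_neg_mul_Ioi ha hb]
    have : (√(2 * π))⁻¹ * √(π / (1 / 2 - t)) = √ ((1 / 2) * (1 / (1 / 2 - t))) := by
      rw [← Real.sqrt_inv, ← Real.sqrt_mul (by positivity)]
      congr 1
      field_simp
    rw [this, Real.sqrt_eq_rpow, ← Real.rpow_natCast, ← Real.rpow_mul (by positivity),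
      show (1 / 2 : ℝ) * d = d / 2 by ring, Real.mul_rpow (by positivity) (by positivity)]
    field_simp
  · have hb : 1 / 2 - t ≤ 0 := by linarith
    rw [Real.sqrt_eq_zero_of_nonpos (div_nonpos_of_nonneg_of_nonpos pi_pos.le hb), mul_zero,
      zero_pow (by omega), integral_undef, mul_zero]
    intro h
    refine not_integrableOn_Ioi_rpow ((d : ℝ) / 2 - 1) ?_
    refine Integrable.mono' h (by fun_prop) ?_
    filter_upwards [ae_restrict_mem measurableSet_Ioi] with x hx
    have hx' : 0 < x := hx
    have h0 : 0 < x ^ ((d : ℝ) / 2 - 1) := Real.rpow_pos_of_pos hx' _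
    rw [Real.norm_of_nonneg h0.le]
    refine le_mul_of_one_le_right h0.le (Real.one_le_exp ?_)
    nlinarith

/-- If `Z = (Z₁, …, Z_d)` has law the `d`-fold product of standard
normal distributions, then `∑ i, Zᵢ²` has the gamma distribution with shape `d/2` and
rate `1/2` (the chi-squared distribution with `d` degrees of freedom): the pushforward
of the product Gaussian measure under `z ↦ ∑ i, (z i)²` is the gamma measure. -/
theorem stmt_13 (d : ℕ) (hd : 1 ≤ d) :
    Measure.map (fun z : Fin d → ℝ => ∑ i, (z i) ^ 2)
        (Measure.pi fun _ : Fin d => gaussianReal 0 1) =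
      gammaMeasure ((d : ℝ) / 2) (1 / 2) := by
  have ha : 0 < (d : ℝ) / 2 := by
    have : 0 < d := hd
    positivity
  have hmgf := aux_mgf_eq d hd
  have hg := aux_mgf_gauss d
  have : IsProbabilityMeasure (gammaMeasure ((d : ℝ) / 2) (1 / 2)) :=
    isProbabilityMeasure_gammaMeasure ha (by norm_num)
  have : IsProbabilityMeasure (Measure.map (fun z : Fin d → ℝ => ∑ i, (z i) ^ 2)
        (Measure.pi fun _ : Fin d => gaussianReal 0 1)) :=
    Measure.isProbabilityMeasure_map (Measurable.aemeasurable (by fun_prop))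
  generalize Measure.map (fun z : Fin d → ℝ => ∑ i, (z i) ^ 2)
        (Measure.pi fun _ : Fin d => gaussianReal 0 1) = μ at *
  have hE := eqOn_complexMGF_of_mgf hmgf
  have h0 : (0 : ℝ) ∈ interior (integrableExpSet id μ) := by
    refine mem_interior.2 ⟨Iio (1 / 2), ?_, isOpen_Iio, by norm_num⟩
    intro t ht
    have hb : 0 < 1 / 2 - t := sub_pos.2 ht
    by_contra hn
    have h := hg t
    rw [mgf_undef hn] at h
    have : 0 < ((√(2 * π))⁻¹ * √(π / (1 / 2 - t))) ^ d := by positivity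
    exact this.ne h
  refine Measure.ext_of_charFun ?_
  ext t
  rw [← complexMGF_id_mul_I, ← complexMGF_id_mul_I]
  apply hE
  simpa using h0
end
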